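/- Let Ω be a closed convex domain in ℝⁿ and let f be a continuously differentiable real-valued function on Ω. For u ∈ Ω define S_u = {t ∈ Ω : g_t(u) ≥ f(u)}. Then for every x ∈ Ω, f(x) = sup_{u∈Ω} inf_{t∈S_u} g_t(x), where the infima and the supremum are taken in the extended real numbers. -/

import Mathlib

open RealInnerProductSpace

open Set Filter Topology

/-- A function vanishing at `0` and `1` has a zero in `[0, 1]` where its derivative is
nonpositive. -/
lemma exists_zero_deriv_nonpos {k k' : ℝ → ℝ} (hk : ∀ s ∈ Icc (0 : ℝ) 1, HasDerivAt k (k' s) s)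
    (h0 : k 0 = 0) (h1 : k 1 = 0) : ∃ c ∈ Icc (0 : ℝ) 1, k c = 0 ∧ k' c ≤ 0 := by
  by_cases hd : k' 0 ≤ 0
  · exact ⟨0, by simp, h0, hd⟩
  push Not at hd
  obtain ⟨a, ha, ha0, ha1⟩ : ∃ a, 0 < k a ∧ 0 < a ∧ a < 1 := by
    have hslope := (hasDerivAt_iff_tendsto_slope.1 (hk 0 (by simp))).mono_left
      (nhdsGT_le_nhdsNE (0 : ℝ))
    have hpos := hslope.eventually (lt_mem_nhds hd)
    obtain ⟨a, has, ha⟩ := (hpos.and (Ioo_mem_nhdsGT (zero_lt_one' ℝ))).exists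
    refine ⟨a, ?_, ha.1, ha.2⟩
    rw [slope_def_field, h0, sub_zero, sub_zero] at has
    exact (div_pos_iff_of_pos_right ha.1).1 has
  have hcont : ContinuousOn k (Icc a 1) := fun s hs =>
    (hk s ⟨ha0.le.trans hs.1, hs.2⟩).continuousAt.continuousWithinAt
  have hcomp : IsCompact (Icc a 1 ∩ k ⁻¹' Iic 0) :=
    isCompact_Icc.of_isClosed_subset (hcont.preimage_isClosed_of_isClosed isClosed_Icc isClosed_Iic)
      inter_subset_left
  obtain ⟨c, ⟨hc, hkc⟩, hmin⟩ := hcomp.exists_isLeast ⟨1, ⟨ha1.le, le_rfl⟩, h1.le⟩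
  have hkc : k c ≤ 0 := hkc
  have hac : a < c := hc.1.lt_of_ne (by rintro rfl; exact hkc.not_gt ha)
  have hpos : ∀ᶠ s in 𝓝[<] c, s < c ∧ 0 < k s := by
    filter_upwards [Ioo_mem_nhdsLT hac] with s hs
    refine ⟨hs.2, ?_⟩
    by_contra! hks
    exact (hmin ⟨⟨hs.1.le, hs.2.le.trans hc.2⟩, hks⟩).not_gt hs.2
  have hc01 : c ∈ Icc (0 : ℝ) 1 := ⟨ha0.le.trans hc.1, hc.2⟩
  refine ⟨c, hc01, hkc.antisymm ?_, ?_⟩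
  · exact ge_of_tendsto ((hk c hc01).continuousAt.tendsto.mono_left nhdsWithin_le_nhds)
      (hpos.mono fun s hs => hs.2.le)
  · refine le_of_tendsto ((hasDerivAt_iff_tendsto_slope.1 (hk c hc01)).mono_left
      (nhdsLT_le_nhdsNE c)) (hpos.mono fun s hs => ?_)
    rw [slope_def_field]
    exact div_nonpos_of_nonneg_of_nonpos (by linarith [hs.2]) (by linarith [hs.1])

/-- Some tangent line of a differentiable function on `[0, 1]` lies above the graph at `0` and
below the graph at `1`. -/
lemma exists_tangent_ge_left_le_right {h h' : ℝ → ℝ}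
    (hh : ∀ s ∈ Icc (0 : ℝ) 1, HasDerivAt h (h' s) s) :
    ∃ c ∈ Icc (0 : ℝ) 1, h 0 ≤ h c - c * h' c ∧ h c + (1 - c) * h' c ≤ h 1 := by
  obtain ⟨c, hc, hkc, hdc⟩ := exists_zero_deriv_nonpos
    (k := fun s => h s - (h 0 + s * (h 1 - h 0))) (k' := fun s => h' s - (1 * (h 1 - h 0)))
    (fun s hs => (hh s hs).sub (((hasDerivAt_id s).mul_const _).const_add _))
    (by simp) (by simp)
  refine ⟨c, hc, ?_, ?_⟩
  · nlinarith [hc.1]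
  · nlinarith [hc.2]

/-- (Ovchinnikov, proof of Theorem 3.1.) Let `Ω ⊆ ℝⁿ` be a closed convex domain (the closure
of a nonempty open convex set), `f` continuously differentiable on `Ω` with gradient `f'`,
`g t x = ⟨∇f(t), x − t⟩ + f(t)`, and for `u ∈ Ω` let `S u = {t ∈ Ω : g t u ≥ f u}`.
Then for every `x ∈ Ω`, `f(x) = ⨆ u ∈ Ω, ⨅ t ∈ S u, g t x` in the extended reals. -/
theorem stmt_4 {n : ℕ} (U Ω : Set (EuclideanSpace ℝ (Fin n)))
    (hUopen : IsOpen U) (hUne : U.Nonempty) (hUconv : Convex ℝ U)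
    (hΩ : Ω = closure U)
    (f : EuclideanSpace ℝ (Fin n) → ℝ)
    (f' : EuclideanSpace ℝ (Fin n) → EuclideanSpace ℝ (Fin n))
    (hf : ∀ t ∈ Ω, HasGradientAt f (f' t) t)
    (hf' : ContinuousOn f' Ω)
    (g : EuclideanSpace ℝ (Fin n) → EuclideanSpace ℝ (Fin n) → ℝ)
    (hg : ∀ t x, g t x = ⟪f' t, x - t⟫ + f t)
    (S : EuclideanSpace ℝ (Fin n) → Set (EuclideanSpace ℝ (Fin n)))
    (hS : ∀ u, S u = {t ∈ Ω | g t u ≥ f u}) :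
    ∀ x ∈ Ω, (f x : EReal) = ⨆ u ∈ Ω, ⨅ t ∈ S u, (g t x : EReal) := by
  intro x hx
  have hconv : Convex ℝ Ω := hΩ ▸ hUconv.closure
  apply le_antisymm
  · refine le_iSup₂_of_le x hx (le_iInf₂ fun t ht => ?_)
    rw [hS] at ht
    exact EReal.coe_le_coe_iff.2 ht.2
  · refine iSup₂_le fun u hu => ?_
    have hmem : ∀ s ∈ Icc (0 : ℝ) 1, u + s • (x - u) ∈ Ω := fun s hs =>
      hconv.add_smul_sub_mem hu hx hs
    obtain ⟨c, hc, hleft, hright⟩ := exists_tangent_ge_left_le_right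
      (h := fun s => f (u + s • (x - u))) (h' := fun s => ⟪f' (u + s • (x - u)), x - u⟫)
      (fun s hs => by
        have hline : HasDerivAt (fun s : ℝ => u + s • (x - u)) (x - u) s := by
          simpa using ((hasDerivAt_id s).smul_const (x - u)).const_add u
        exact (hf _ (hmem s hs)).hasFDerivAt.comp_hasDerivAt s hline)
    simp only [zero_smul, add_zero, one_smul, add_sub_cancel] at hleft hright
    refine iInf₂_le_of_le (u + c • (x - u)) ?_ (EReal.coe_le_coe_iff.2 ?_)
    · rw [hS]
      refine ⟨hmem c hc, ?_⟩
      have hvec : u - (u + c • (x - u)) = (-c) • (x - u) := by module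
      rw [hg, hvec, real_inner_smul_right]
      linarith
    · have hvec : x - (u + c • (x - u)) = (1 - c) • (x - u) := by module
      rw [hg, hvec, real_inner_smul_right]
      linarith
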